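/- arXiv:1911.12891 — 6 statements merged into one kernel-verified Lean document; each statement's English description precedes it below -/
import Mathlib

section
/- Let n, m ≥ 1 be integers and set T = N_n ⊗ id + id ⊗ N_m on K^n ⊗ K^m. Then T^{n+m−1} = 0 and T^{n+m−2} ≠ 0; in particular T is nilpotent of nilpotency index exactly n+m−1. -/
open TensorProduct

/-- The nilpotent shift operator `N_r` on `K^r`, sending the standard basis vector `e_j` to
`e_{j+1}` for `0 ≤ j < r-1` and `e_{r-1}` to `0` (the monodromy operator of the segment
`[0, r-1]`). -/
noncomputable def shiftOp (K : Type*) [Field K] (r : ℕ) : (Fin r → K) →ₗ[K] (Fin r → K) where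
  toFun x k := if h : (k : ℕ) = 0 then 0 else x ⟨(k : ℕ) - 1, by have := k.isLt; omega⟩
  map_add' x y := by funext k; by_cases h : (k : ℕ) = 0 <;> simp [h]
  map_smul' a x := by funext k; by_cases h : (k : ℕ) = 0 <;> simp [h]

/-- The operator `N_n ⊗ id + id ⊗ N_m` on `K^n ⊗ K^m`. -/
noncomputable def tensorShift (K : Type*) [Field K] (n m : ℕ) :
    ((Fin n → K) ⊗[K] (Fin m → K)) →ₗ[K] ((Fin n → K) ⊗[K] (Fin m → K)) :=
  TensorProduct.map (shiftOp K n) LinearMap.id + TensorProduct.map LinearMap.id (shiftOp K m)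

theorem shiftOp_pow_apply (K : Type*) [Field K] (r k : ℕ) (x : Fin r → K) (j : Fin r) :
    (shiftOp K r ^ k) x j = if (j : ℕ) < k then 0 else x ⟨j - k, by omega⟩ := by
  induction k generalizing x with
  | zero => simp
  | succ k ih =>
    rw [pow_succ, Module.End.mul_apply, ih]
    simp only [shiftOp, LinearMap.coe_mk, AddHom.coe_mk]
    split_ifs <;> first | rfl | omega

theorem shiftOp_pow_eq_zero (K : Type*) [Field K] {r k : ℕ} (h : r ≤ k) :
    shiftOp K r ^ k = 0 := by
  refine LinearMap.ext fun x ↦ funext fun j ↦ ?_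
  rw [shiftOp_pow_apply, if_pos (j.isLt.trans_le h)]
  rfl

theorem commute_map_id_map_id {R M N : Type*} [CommSemiring R] [AddCommMonoid M]
    [AddCommMonoid N] [Module R M] [Module R N] (f : Module.End R M) (g : Module.End R N) :
    Commute (TensorProduct.map f LinearMap.id : Module.End R (M ⊗[R] N))
      (TensorProduct.map LinearMap.id g) := by
  refine TensorProduct.ext' fun x y ↦ ?_
  simp

theorem map_id_pow {R M N : Type*} [CommSemiring R] [AddCommMonoid M]
    [AddCommMonoid N] [Module R M] [Module R N] (f : Module.End R M) (k : ℕ) :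
    (TensorProduct.map f LinearMap.id : Module.End R (M ⊗[R] N)) ^ k =
      TensorProduct.map (f ^ k) LinearMap.id := by
  rw [TensorProduct.map_pow]
  exact congrArg _ (one_pow k)

theorem id_map_pow {R M N : Type*} [CommSemiring R] [AddCommMonoid M]
    [AddCommMonoid N] [Module R M] [Module R N] (g : Module.End R N) (k : ℕ) :
    (TensorProduct.map LinearMap.id g : Module.End R (M ⊗[R] N)) ^ k =
      TensorProduct.map LinearMap.id (g ^ k) := by
  rw [TensorProduct.map_pow]
  exact congrArg (TensorProduct.map · (g ^ k)) (one_pow k)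

/-- Only one term of the binomial expansion of the top power of `T` survives. -/
theorem tensorShift_pow_add (K : Type*) [Field K] (a b : ℕ) :
    tensorShift K (a + 1) (b + 1) ^ (a + b) =
      (a + b).choose a •
        TensorProduct.map (shiftOp K (a + 1) ^ a) (shiftOp K (b + 1) ^ b) := by
  rw [tensorShift, (commute_map_id_map_id _ _).add_pow', Finset.sum_eq_single (a, b)]
  · rw [map_id_pow, id_map_pow, ← TensorProduct.map_mul]
    rfl
  · rintro ⟨i, j⟩ hij hne
    rw [Finset.HasAntidiagonal.mem_antidiagonal] at hij
    dsimp only at hij ⊢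
    rw [map_id_pow, id_map_pow]
    obtain h | h : a + 1 ≤ i ∨ b + 1 ≤ j := by
      by_contra! h
      exact hne (Prod.ext (by dsimp only; omega) (by dsimp only; omega))
    · simp [shiftOp_pow_eq_zero K h]
    · simp [shiftOp_pow_eq_zero K h]
  · simp

/-- The operator `T = N_n ⊗ id + id ⊗ N_m` on `K^n ⊗ K^m` satisfies `T^(n+m-1) = 0` and
`T^(n+m-2) ≠ 0`: it is nilpotent of nilpotency index exactly `n+m-1`. -/
theorem tensorShift_nilpotency_index (K : Type*) [Field K] [CharZero K]
    (n m : ℕ) (hn : 1 ≤ n) (hm : 1 ≤ m) :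
    tensorShift K n m ^ (n + m - 1) = 0 ∧ tensorShift K n m ^ (n + m - 2) ≠ 0 := by
  constructor
  · refine (commute_map_id_map_id _ _).add_pow_eq_zero_of_add_le_succ_of_pow_eq_zero
      (m := n) (n := m) ?_ ?_ (by omega)
    · simp [shiftOp_pow_eq_zero]
    · simp [shiftOp_pow_eq_zero]
  · obtain ⟨a, rfl⟩ := Nat.exists_eq_add_of_le' hn
    obtain ⟨b, rfl⟩ := Nat.exists_eq_add_of_le' hm
    rw [show a + 1 + (b + 1) - 2 = a + b by omega, tensorShift_pow_add]
    intro h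
    have key := congrArg (fun z ↦ LinearMap.mul' K K (TensorProduct.map
      (LinearMap.proj (Fin.last a)) (LinearMap.proj (Fin.last b)) z))
      (LinearMap.congr_fun h ((fun _ ↦ 1) ⊗ₜ (fun _ ↦ 1)))
    simp only [LinearMap.smul_apply, LinearMap.zero_apply, map_nsmul, map_zero,
      TensorProduct.map_tmul, LinearMap.mul'_apply, LinearMap.proj_apply, shiftOp_pow_apply,
      Fin.val_last, lt_irrefl, if_false, mul_one] at key
    rw [nsmul_eq_mul, mul_one, Nat.cast_eq_zero] at key
    exact (Nat.choose_pos (Nat.le_add_right a b)).ne' key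
end

section
/- Let n ≥ m ≥ 1 and r ≥ 0 be integers and set T = N_n ⊗ id + id ⊗ N_m on K^n ⊗ K^m. Then the rank of T^r equals Σ_{i=0}^{m−1} max(n+m−1−2i−r, 0). (Rank form of the tensor product decomposition of segments of Lemma 2.2 in characteristic zero.) -/
open TensorProduct

/-- If the ends of Jordan chains of lengths `L i + 1` are linearly independent and these lengths add
up to the dimension of the space, then they determine the ranks of all powers. -/
theorem finrank_range_pow_of_chains {K V ι : Type*} [Field K] [AddCommGroup V] [Module K V]
    [FiniteDimensional K V] [Fintype ι] (T : Module.End K V) (L : ι → ℕ) (w : ι → V)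
    (hker : ∀ i, T ((T ^ L i) (w i)) = 0)
    (hli : LinearIndependent K fun i => (T ^ L i) (w i))
    (hdim : Module.finrank K V = ∑ i, (L i + 1)) (r : ℕ) :
    Module.finrank K (LinearMap.range (T ^ r)) = ∑ i, (L i + 1 - r) := by
  classical
  have step (s : ℕ) : Module.finrank K (LinearMap.range (T ^ (s + 1)))
      + Fintype.card {i // s ≤ L i} ≤ Module.finrank K (LinearMap.range (T ^ s)) := by
    have hrange : LinearMap.range (T.domRestrict (LinearMap.range (T ^ s)))
        = LinearMap.range (T ^ (s + 1)) := by
      rw [LinearMap.range_domRestrict, pow_succ', Module.End.mul_eq_comp, LinearMap.range_comp]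
    have hrn := LinearMap.finrank_range_add_finrank_ker
      (T.domRestrict (LinearMap.range (T ^ s)))
    rw [hrange] at hrn
    rw [← hrn]
    gcongr
    have hmem (i : {i // s ≤ L i}) : (T ^ L i) (w i) ∈ LinearMap.range (T ^ s) :=
      ⟨(T ^ (L i - s)) (w i), by
        rw [← Module.End.mul_apply, ← pow_add, Nat.add_sub_cancel' i.2]⟩
    let v (i : {i // s ≤ L i}) : LinearMap.ker (T.domRestrict (LinearMap.range (T ^ s))) :=
      ⟨⟨(T ^ L i) (w i), hmem i⟩, by simpa using hker i⟩
    have hv : LinearIndependent K v := by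
      apply LinearIndependent.of_comp
        ((LinearMap.range (T ^ s)).subtype ∘ₗ (LinearMap.ker _).subtype)
      exact hli.comp _ Subtype.val_injective
    exact hv.fintype_card_le_finrank
  have count (s : ℕ) : ∑ i, (L i + 1 - s)
      = ∑ i, (L i + 1 - (s + 1)) + Fintype.card {i // s ≤ L i} := by
    rw [Fintype.card_subtype, Finset.card_filter, ← Finset.sum_add_distrib]
    refine Finset.sum_congr rfl fun i _ => ?_
    split_ifs <;> omega
  have defect (s : ℕ) : ∑ i, (L i + 1 - r) + Module.finrank K (LinearMap.range (T ^ (r + s)))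
      ≤ Module.finrank K (LinearMap.range (T ^ r)) + ∑ i, (L i + 1 - (r + s)) := by
    induction s with
    | zero => simp [add_comm]
    | succ s ih => have := step (r + s); have := count (r + s); grind
  have upper (s : ℕ) : Module.finrank K (LinearMap.range (T ^ s)) ≤ ∑ i, (L i + 1 - s) := by
    induction s with
    | zero => simpa [← hdim] using Submodule.finrank_le _
    | succ s ih => have := step s; have := count s; omega
  have hzero : ∑ i, (L i + 1 - (r + ∑ i, (L i + 1))) = 0 := by
    refine Finset.sum_eq_zero fun i _ => ?_
    have := Finset.single_le_sum (f := fun i => L i + 1) (fun _ _ => Nat.zero_le _)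
      (Finset.mem_univ i)
    grind
  have := defect (∑ i, (L i + 1))
  have := upper r
  omega

open Polynomial

/-- The embedding of `K^n` into `K[X]` sending `e_j` to the divided power
`X^(n-1-j) / (n-1-j)!`; it turns the shift into the derivative. -/
noncomputable def dividedPowerMap (K : Type*) [Field K] (n : ℕ) : (Fin n → K) →ₗ[K] K[X] :=
  Fintype.linearCombination K fun j : Fin n =>
    monomial (j.rev : ℕ) ((Nat.factorial (j.rev : ℕ) : K)⁻¹)

theorem coeff_dividedPowerMap {K : Type*} [Field K] {n : ℕ} (v : Fin n → K) (k : ℕ) :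
    (dividedPowerMap K n v).coeff k
      = if h : k < n then v (Fin.rev ⟨k, h⟩) * (Nat.factorial k : K)⁻¹ else 0 := by
  simp only [dividedPowerMap, Fintype.linearCombination_apply, finsetSum_coeff, coeff_smul,
    coeff_monomial, smul_eq_mul]
  split_ifs with h
  · rw [Finset.sum_eq_single (Fin.rev ⟨k, h⟩)]
    · simp
    · intro j _ hj
      rw [if_neg, mul_zero]
      rintro rfl
      exact hj (Fin.rev_rev j).symm
    · simp
  · refine Finset.sum_eq_zero fun j _ => ?_
    rw [if_neg, mul_zero]
    have := j.rev.isLt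
    omega

theorem dividedPowerMap_injective (K : Type*) [Field K] [CharZero K] (n : ℕ) :
    Function.Injective (dividedPowerMap K n) := by
  rw [← LinearMap.ker_eq_bot, LinearMap.ker_eq_bot']
  intro v hv
  funext j
  have h := coeff_dividedPowerMap v (j.rev : ℕ)
  rw [hv, coeff_zero, dif_pos j.rev.isLt, Fin.eta, Fin.rev_rev, eq_comm, mul_eq_zero] at h
  exact h.resolve_right (inv_ne_zero (by exact_mod_cast Nat.factorial_ne_zero _))

theorem dividedPowerMap_shiftOp {K : Type*} [Field K] [CharZero K] {n : ℕ} (v : Fin n → K) :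
    dividedPowerMap K n (shiftOp K n v) = derivative (dividedPowerMap K n v) := by
  ext k
  rw [coeff_derivative, coeff_dividedPowerMap, coeff_dividedPowerMap]
  by_cases h : k + 1 < n
  · have hk : k < n := by omega
    have hne : n - (k + 1) ≠ 0 := by omega
    have h1 : ((k : K) + 1) ≠ 0 := by exact_mod_cast k.succ_ne_zero
    have h2 : (Nat.factorial k : K) ≠ 0 := by exact_mod_cast k.factorial_ne_zero
    simp only [h, hk, dif_pos, shiftOp, LinearMap.coe_mk, AddHom.coe_mk, Fin.val_rev, hne,
      dif_neg, not_false_eq_true, Nat.factorial_succ, Nat.cast_mul, Nat.cast_succ]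
    have : (⟨n - (k + 1) - 1, by omega⟩ : Fin n) = Fin.rev ⟨k + 1, h⟩ := by
      ext; simp; omega
    rw [this]
    field_simp
  · rw [dif_neg h, zero_mul]
    split_ifs with hk
    · have : n - (k + 1) = 0 := by omega
      simp [shiftOp, this]
    · rfl

theorem X_pow_mem_range_dividedPowerMap {K : Type*} [Field K] [CharZero K] {n k : ℕ}
    (hk : k < n) : (X ^ k : K[X]) ∈ LinearMap.range (dividedPowerMap K n) := by
  refine ⟨Pi.single (Fin.rev ⟨k, hk⟩) (Nat.factorial k : K), ?_⟩
  have h2 : (Nat.factorial k : K) ≠ 0 := by exact_mod_cast k.factorial_ne_zero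
  rw [dividedPowerMap, Fintype.linearCombination_apply_single, Fin.rev_rev, smul_monomial,
    smul_eq_mul, mul_inv_cancel₀ h2, X_pow_eq_monomial]

/-- The operator `∂/∂x + ∂/∂y` on `K[x, y] = K[X] ⊗ K[X]`. -/
noncomputable def totalDerivative (K : Type*) [Field K] : Module.End K (K[X] ⊗[K] K[X]) :=
  TensorProduct.map derivative LinearMap.id + TensorProduct.map LinearMap.id derivative

theorem totalDerivative_tmul {K : Type*} [Field K] (p q : K[X]) :
    totalDerivative K (p ⊗ₜ q) = derivative p ⊗ₜ q + p ⊗ₜ derivative q := by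
  simp [totalDerivative]

theorem totalDerivative_mul {K : Type*} [Field K] (a b : K[X] ⊗[K] K[X]) :
    totalDerivative K (a * b) = totalDerivative K a * b + a * totalDerivative K b := by
  induction a with
  | zero => simp
  | add a₁ a₂ h₁ h₂ => simp only [add_mul, map_add, h₁, h₂]; ring
  | tmul p q =>
    induction b with
    | zero => simp
    | add b₁ b₂ h₁ h₂ => simp only [mul_add, map_add, h₁, h₂]; ring
    | tmul p' q' =>
      simp only [Algebra.TensorProduct.tmul_mul_tmul, totalDerivative_tmul, derivative_mul,
        TensorProduct.add_tmul, TensorProduct.tmul_add, add_mul, mul_add]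
      abel

theorem totalDerivative_pow_mul {K : Type*} [Field K] {a : K[X] ⊗[K] K[X]}
    (ha : totalDerivative K a = 0) (b : K[X] ⊗[K] K[X]) (k : ℕ) :
    (totalDerivative K ^ k) (a * b) = a * (totalDerivative K ^ k) b := by
  induction k with
  | zero => simp
  | succ k ih => simp [pow_succ', ih, totalDerivative_mul, ha]

theorem totalDerivative_pow_eq_zero {K : Type*} [Field K] {a : K[X] ⊗[K] K[X]}
    (ha : totalDerivative K a = 0) (k : ℕ) : totalDerivative K (a ^ k) = 0 := by
  induction k with
  | zero => simp [Algebra.TensorProduct.one_def, totalDerivative_tmul]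
  | succ k ih => simp [pow_succ, totalDerivative_mul, ih, ha]

theorem totalDerivative_X_sub_X (K : Type*) [Field K] :
    totalDerivative K (X ⊗ₜ 1 - 1 ⊗ₜ X) = 0 := by
  simp [totalDerivative_tmul]

theorem totalDerivative_pow_X_pow_tmul_X_pow {K : Type*} [Field K] {N a b : ℕ} (h : a + b = N) :
    (totalDerivative K ^ N) ((X ^ a : K[X]) ⊗ₜ (X ^ b : K[X])) = (Nat.factorial N : K) • 1 := by
  induction N generalizing a b with
  | zero =>
    obtain ⟨rfl, rfl⟩ : a = 0 ∧ b = 0 := by omega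
    simp [Algebra.TensorProduct.one_def]
  | succ N ih =>
    have hsplit : totalDerivative K ((X ^ a : K[X]) ⊗ₜ (X ^ b : K[X]))
        = (a : K) • ((X ^ (a - 1) : K[X]) ⊗ₜ (X ^ b : K[X]))
          + (b : K) • ((X ^ a : K[X]) ⊗ₜ (X ^ (b - 1) : K[X])) := by
      rw [totalDerivative_tmul, derivative_X_pow, derivative_X_pow, ← smul_eq_C_mul,
        ← smul_eq_C_mul, TensorProduct.smul_tmul', TensorProduct.tmul_smul]
    have hl : (a : K) • (totalDerivative K ^ N) ((X ^ (a - 1) : K[X]) ⊗ₜ (X ^ b : K[X]))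
        = (a : K) • (Nat.factorial N : K) • 1 := by
      rcases Nat.eq_zero_or_pos a with rfl | ha
      · simp
      · rw [ih (by omega)]
    have hr : (b : K) • (totalDerivative K ^ N) ((X ^ a : K[X]) ⊗ₜ (X ^ (b - 1) : K[X]))
        = (b : K) • (Nat.factorial N : K) • 1 := by
      rcases Nat.eq_zero_or_pos b with rfl | hb
      · simp
      · rw [ih (by omega)]
    rw [pow_succ, Module.End.mul_apply, hsplit, map_add, map_smul, map_smul, hl, hr, ← add_smul,
      smul_smul, ← Nat.cast_add, h, ← Nat.cast_mul, Nat.factorial_succ]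

theorem linearIndependent_X_sub_X_pow (K : Type*) [Field K] :
    LinearIndependent K fun i : ℕ => (X ⊗ₜ 1 - 1 ⊗ₜ X : K[X] ⊗[K] K[X]) ^ i := by
  apply LinearIndependent.of_comp
    (Algebra.TensorProduct.productMap (AlgHom.id K K[X]) (aeval (0 : K[X]))).toLinearMap
  have h : ⇑(Algebra.TensorProduct.productMap (AlgHom.id K K[X]) (aeval (0 : K[X]))).toLinearMap ∘
      (fun i : ℕ => (X ⊗ₜ 1 - 1 ⊗ₜ X : K[X] ⊗[K] K[X]) ^ i) = Polynomial.basisMonomials K := by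
    funext i
    simp [X_pow_eq_monomial]
  rw [h]
  exact (Polynomial.basisMonomials K).linearIndependent

/-- The embedding of `K^n ⊗ K^m` into `K[x, y]`, intertwining `T` with `∂/∂x + ∂/∂y`. -/
noncomputable def tensorDividedPowerMap (K : Type*) [Field K] (n m : ℕ) :
    ((Fin n → K) ⊗[K] (Fin m → K)) →ₗ[K] K[X] ⊗[K] K[X] :=
  TensorProduct.map (dividedPowerMap K n) (dividedPowerMap K m)

theorem tensorDividedPowerMap_injective (K : Type*) [Field K] [CharZero K] (n m : ℕ) :
    Function.Injective (tensorDividedPowerMap K n m) :=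
  TensorProduct.map_injective_of_flat_flat _ _ (dividedPowerMap_injective K n)
    (dividedPowerMap_injective K m)

theorem tensorDividedPowerMap_tensorShift {K : Type*} [Field K] [CharZero K] {n m : ℕ}
    (z : (Fin n → K) ⊗[K] (Fin m → K)) :
    tensorDividedPowerMap K n m (tensorShift K n m z)
      = totalDerivative K (tensorDividedPowerMap K n m z) := by
  induction z with
  | zero => simp
  | add z₁ z₂ h₁ h₂ => simp only [map_add, h₁, h₂]
  | tmul v w =>
    simp [tensorDividedPowerMap, tensorShift, totalDerivative_tmul, dividedPowerMap_shiftOp]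

theorem tensorDividedPowerMap_tensorShift_pow {K : Type*} [Field K] [CharZero K] {n m : ℕ}
    (k : ℕ) (z : (Fin n → K) ⊗[K] (Fin m → K)) :
    tensorDividedPowerMap K n m ((tensorShift K n m ^ k) z)
      = (totalDerivative K ^ k) (tensorDividedPowerMap K n m z) := by
  induction k with
  | zero => simp
  | succ k ih => simp [pow_succ', tensorDividedPowerMap_tensorShift, ih]

theorem mem_range_tensorDividedPowerMap {K : Type*} [Field K] [CharZero K] {n m i a b : ℕ}
    (ha : i + a < n) (hb : i + b < m) :
    (X ⊗ₜ 1 - 1 ⊗ₜ X : K[X] ⊗[K] K[X]) ^ i * (X ^ a) ⊗ₜ (X ^ b)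
      ∈ LinearMap.range (tensorDividedPowerMap K n m) := by
  induction i generalizing a b with
  | zero =>
    obtain ⟨v, hv⟩ := X_pow_mem_range_dividedPowerMap (K := K) (n := n) (k := a) (by omega)
    obtain ⟨w, hw⟩ := X_pow_mem_range_dividedPowerMap (K := K) (n := m) (k := b) (by omega)
    exact ⟨v ⊗ₜ w, by simp [tensorDividedPowerMap, hv, hw]⟩
  | succ i ih =>
    rw [pow_succ, mul_assoc, sub_mul, mul_sub, Algebra.TensorProduct.tmul_mul_tmul,
      Algebra.TensorProduct.tmul_mul_tmul, one_mul, one_mul, ← pow_succ', ← pow_succ']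
    exact Submodule.sub_mem _ (ih (by omega) (by omega)) (ih (by omega) (by omega))

theorem sum_segment_lengths {n m : ℕ} (hmn : m ≤ n) :
    ∑ i : Fin m, (n + m - 2 - 2 * (i : ℕ) + 1) = n * m := by
  rw [Fin.sum_univ_eq_sum_range (fun i => n + m - 2 - 2 * i + 1)]
  induction m generalizing n with
  | zero => simp
  | succ m ih =>
    obtain ⟨n, rfl⟩ : ∃ k, n = k + 1 := ⟨n - 1, by omega⟩
    rw [Finset.sum_range_succ']
    have hshift : ∑ i ∈ Finset.range m, (n + 1 + (m + 1) - 2 - 2 * (i + 1) + 1)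
        = ∑ i ∈ Finset.range m, (n + m - 2 - 2 * i + 1) :=
      Finset.sum_congr rfl fun i _ => by omega
    rw [hshift, ih (by omega)]
    have : n + 1 + (m + 1) - 2 - 2 * 0 + 1 = n + m + 1 := by omega
    rw [this]
    ring

/-- Rank form of the tensor product decomposition of segments: for `n ≥ m ≥ 1` and `r ≥ 0`,
the rank of `T^r` (`T = N_n ⊗ id + id ⊗ N_m` on `K^n ⊗ K^m`) equals
`Σ_{i=0}^{m-1} max(n+m-1-2i-r, 0)` (here expressed with truncated subtraction on `ℕ`). -/
theorem finrank_range_tensorShift_pow (K : Type*) [Field K] [CharZero K]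
    (n m : ℕ) (hm : 1 ≤ m) (hmn : m ≤ n) (r : ℕ) :
    Module.finrank K (LinearMap.range (tensorShift K n m ^ r))
      = ∑ i : Fin m, (n + m - 1 - 2 * (i : ℕ) - r) := by
  let φ := tensorDividedPowerMap K n m
  let T : Module.End K ((Fin n → K) ⊗[K] (Fin m → K)) := tensorShift K n m
  let L (i : Fin m) : ℕ := n + m - 2 - 2 * (i : ℕ)
  have hφ : Function.Injective φ := tensorDividedPowerMap_injective K n m
  have hmem (i : Fin m) := mem_range_tensorDividedPowerMap (K := K) (n := n) (m := m) (i := i)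
    (a := n - 1 - i) (b := m - 1 - i) (by omega) (by omega)
  choose w hw using hmem
  have htop (i : Fin m) : φ ((T ^ L i) (w i))
      = (Nat.factorial (L i) : K) • (X ⊗ₜ 1 - 1 ⊗ₜ X : K[X] ⊗[K] K[X]) ^ (i : ℕ) := by
    rw [tensorDividedPowerMap_tensorShift_pow, hw,
      totalDerivative_pow_mul (totalDerivative_pow_eq_zero (totalDerivative_X_sub_X K) _),
      totalDerivative_pow_X_pow_tmul_X_pow (by grind), mul_smul_comm, mul_one]
  have hker (i : Fin m) : T ((T ^ L i) (w i)) = 0 := by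
    apply hφ
    rw [tensorDividedPowerMap_tensorShift, htop, map_smul,
      totalDerivative_pow_eq_zero (totalDerivative_X_sub_X K), smul_zero, map_zero]
  have hli : LinearIndependent K fun i => (T ^ L i) (w i) := by
    apply LinearIndependent.of_comp φ
    convert ((linearIndependent_X_sub_X_pow K).comp _ Fin.val_injective).units_smul
      (fun i : Fin m => Units.mk0 (Nat.factorial (L i) : K)
        (by exact_mod_cast Nat.factorial_ne_zero _)) using 1
    funext i
    exact htop i
  refine (finrank_range_pow_of_chains T L w hker hli ?_ r).trans ?_
  · rw [sum_segment_lengths hmn]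
    simp
  · refine Finset.sum_congr rfl fun i _ => ?_
    have := i.isLt
    dsimp only [L]
    omega
end

section
/- The images of Nilp and of CPar in the quotient group G ⧸ G₀ coincide: h(Nilp) = h(CPar). (Abstract form of the equality Im(h_Nilp) = Im(h_C) of Proposition 4.3.) -/
/-! Abstract setting for the combinatorics of Section 4 of the paper: `ι` indexes pairs
`(ℤ_Ψ, k)` of an irreducible line and a length, `o i ≥ 1` is the cardinality of the line.
`Sum.inl ⟨i, j⟩` models the indecomposable nilpotent Deligne representation `[0,k-1] ⊗ ν^j Ψ`
and `Sum.inr i` models the cycle representation `[0,k-1] ⊗ 𝒞(ℤ_Ψ)`. -/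

/-- The basis `B = (Σ i, Fin (o i)) ⊕ ι` of indecomposables. -/
abbrev BB (ι : Type*) (o : ι → ℕ) : Type _ := (Σ i : ι, Fin (o i)) ⊕ ι

/-- The free commutative monoid `M = B →₀ ℕ` on `B`, modelling `[Rep_{D,ss}(W_F)]` under `⊕`. -/
abbrev MM (ι : Type*) (o : ι → ℕ) : Type _ := BB ι o →₀ ℕ

/-- The Grothendieck group `G = B →₀ ℤ` of `M`. -/
abbrev GG (ι : Type*) (o : ι → ℕ) : Type _ := BB ι o →₀ ℤ

/-- `s_i = Σ_{j : Fin (o i)} inl (i, j)`, modelling `[0,k-1] ⊗ St₀(ℤ_Ψ)`. -/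
noncomputable def sElt (ι : Type*) (o : ι → ℕ) (i : ι) : MM ι o :=
  ∑ j : Fin (o i), Finsupp.single (Sum.inl ⟨i, j⟩) 1

/-- `c_i = inr i`, modelling the cycle representation `[0,k-1] ⊗ 𝒞(ℤ_Ψ)`. -/
noncomputable def cElt (ι : Type*) (o : ι → ℕ) (i : ι) : MM ι o :=
  Finsupp.single (Sum.inr i) 1

/-- The canonical embedding of `M` into its Grothendieck group `G`. -/
noncomputable def toG (ι : Type*) (o : ι → ℕ) : MM ι o →+ GG ι o :=
  Finsupp.mapRange.addMonoidHom (Nat.castAddMonoidHom ℤ)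

/-- The subgroup `G₀ ≤ G` generated by the differences `s_i - c_i`. -/
noncomputable def Gzero (ι : Type*) (o : ι → ℕ) : AddSubgroup (GG ι o) :=
  AddSubgroup.closure { g | ∃ i : ι, g = toG ι o (sElt ι o i) - toG ι o (cElt ι o i) }

/-- The quotient map `h : G → G ⧸ G₀`. -/
noncomputable def hq (ι : Type*) (o : ι → ℕ) : GG ι o →+ GG ι o ⧸ Gzero ι o :=
  QuotientAddGroup.mk' (Gzero ι o)

/-- `Nilp`: elements of `M` with no cycle component (nilpotent Deligne representations). -/
def NilpSet (ι : Type*) (o : ι → ℕ) : Set (MM ι o) := { f | ∀ i : ι, f (Sum.inr i) = 0 }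

/-- `CPar`: elements of `M` with no complete cycle of nilpotent indecomposables
(C-parameters). -/
def CParSet (ι : Type*) (o : ι → ℕ) : Set (MM ι o) :=
  { f | ∀ i : ι, ∃ j : Fin (o i), f (Sum.inl ⟨i, j⟩) = 0 }

theorem hq_toG_sElt {ι : Type*} (o : ι → ℕ) (i : ι) :
    hq ι o (toG ι o (sElt ι o i)) = hq ι o (toG ι o (cElt ι o i)) := by
  rw [← sub_eq_zero, ← map_sub]
  exact (QuotientAddGroup.eq_zero_iff _).2 (AddSubgroup.subset_closure ⟨i, rfl⟩)

theorem sElt_apply_inl_self {ι : Type*} (o : ι → ℕ) (i : ι) (j : Fin (o i)) :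
    sElt ι o i (Sum.inl ⟨i, j⟩) = 1 := by
  classical
  simp [sElt, Finsupp.finsetSum_apply, Finsupp.single_apply]

theorem sElt_apply_inl_of_ne {ι : Type*} (o : ι → ℕ) {i k : ι} (hik : i ≠ k) (j : Fin (o k)) :
    sElt ι o i (Sum.inl ⟨k, j⟩) = 0 := by
  classical
  simp [sElt, Finsupp.finsetSum_apply, hik]

theorem sElt_apply_inr {ι : Type*} (o : ι → ℕ) (i k : ι) : sElt ι o i (Sum.inr k) = 0 := by
  classical
  simp [sElt, Finsupp.finsetSum_apply]

theorem sElt_le {ι : Type*} (o : ι → ℕ) {i : ι} {f : MM ι o}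
    (hf : ∀ j, f (Sum.inl ⟨i, j⟩) ≠ 0) : sElt ι o i ≤ f := by
  rintro (⟨k, j⟩ | k)
  · by_cases hik : i = k
    · subst hik
      rw [sElt_apply_inl_self]
      exact Nat.one_le_iff_ne_zero.2 (hf j)
    · simp [sElt_apply_inl_of_ne o hik]
  · simp [sElt_apply_inr]

/-- The number of nilpotent indecomposables in `f`, counted with multiplicity. -/
noncomputable def nilpLength (ι : Type*) (o : ι → ℕ) : MM ι o →+ ℕ :=
  Finsupp.liftAddHom (Sum.elim (fun _ => AddMonoidHom.id ℕ) (fun _ => 0))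

theorem nilpLength_sElt {ι : Type*} (o : ι → ℕ) (i : ι) : nilpLength ι o (sElt ι o i) = o i := by
  simp [nilpLength, sElt, -Finsupp.liftAddHom_apply, Finsupp.liftAddHom_apply_single]

theorem nilpLength_cElt {ι : Type*} (o : ι → ℕ) (i : ι) : nilpLength ι o (cElt ι o i) = 0 := by
  simp [nilpLength, cElt, -Finsupp.liftAddHom_apply, Finsupp.liftAddHom_apply_single]

/-- Replacing every cycle `c_i` by `s_i` gives a nilpotent representative. -/
theorem exists_mem_NilpSet {ι : Type*} (o : ι → ℕ) (f : MM ι o) :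
    ∃ g ∈ NilpSet ι o, hq ι o (toG ι o g) = hq ι o (toG ι o f) := by
  induction f using Finsupp.induction_linear with
  | zero => exact ⟨0, fun _ => rfl, rfl⟩
  | add f₁ f₂ h₁ h₂ =>
    obtain ⟨g₁, hg₁, e₁⟩ := h₁
    obtain ⟨g₂, hg₂, e₂⟩ := h₂
    exact ⟨g₁ + g₂, fun i => by simp [hg₁ i, hg₂ i], by simp only [map_add, e₁, e₂]⟩
  | single b n =>
    rcases b with b | i
    · exact ⟨Finsupp.single (Sum.inl b) n, fun i => by simp, rfl⟩
    · refine ⟨n • sElt ι o i, fun k => by simp [sElt_apply_inr], ?_⟩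
      have hn : Finsupp.single (Sum.inr i) n = n • cElt ι o i := by simp [cElt]
      rw [hn]
      simp only [map_nsmul, hq_toG_sElt]

/-- Replacing complete cycles `s_i` by `c_i` as long as possible gives a C-parameter. -/
theorem exists_mem_CParSet {ι : Type*} (o : ι → ℕ) (ho : ∀ i, 1 ≤ o i) (f : MM ι o) :
    ∃ g ∈ CParSet ι o, hq ι o (toG ι o g) = hq ι o (toG ι o f) := by
  induction hn : nilpLength ι o f using Nat.strong_induction_on generalizing f with
  | _ n ih =>
    by_cases hf : f ∈ CParSet ι o
    · exact ⟨f, hf, rfl⟩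
    · simp only [CParSet, Set.mem_ofPred_eq, not_forall, not_exists] at hf
      obtain ⟨i, hi⟩ := hf
      obtain ⟨r, rfl⟩ := exists_add_of_le (sElt_le o hi)
      have hlt : nilpLength ι o (cElt ι o i + r) < n := by
        rw [← hn, map_add, map_add, nilpLength_sElt, nilpLength_cElt]
        have := ho i
        omega
      obtain ⟨g, hg, e⟩ := ih _ hlt _ rfl
      exact ⟨g, hg, e.trans (by simp only [map_add, hq_toG_sElt])⟩

/-- Abstract form of the equality `Im(h_Nilp) = Im(h_C)` of Proposition 4.3: the images of
`Nilp` and of `CPar` in the quotient group `G ⧸ G₀` coincide. -/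
theorem image_Nilp_eq_image_CPar
    {ι : Type*} (o : ι → ℕ) (ho : ∀ i, 1 ≤ o i) :
    (fun f => hq ι o (toG ι o f)) '' NilpSet ι o
      = (fun f => hq ι o (toG ι o f)) '' CParSet ι o := by
  ext x
  constructor
  · rintro ⟨f, -, rfl⟩
    exact exists_mem_CParSet o ho f
  · rintro ⟨f, -, rfl⟩
    exact exists_mem_NilpSet o f
end

section
/- Every coset in the image h(M) of the full monoid M in G ⧸ G₀ contains exactly one element of CPar: for every f ∈ M there exists a unique f' ∈ CPar with f − f' ∈ G₀. (Canonical C-parameter representative, combining the injectivity and image statements of Propositions 4.1 and 4.3.) -/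
theorem toG_apply {ι : Type*} (o : ι → ℕ) (f : MM ι o) (b : BB ι o) :
    toG ι o f b = (f b : ℤ) := rfl

open Classical in
theorem sElt_inl {ι : Type*} (o : ι → ℕ) (i i' : ι) (j : Fin (o i')) :
    sElt ι o i (Sum.inl ⟨i', j⟩) = if i = i' then 1 else 0 := by
  simp only [sElt, Finsupp.finsetSum_apply, Finsupp.single_apply, Sum.inl.injEq]
  split_ifs with h
  · subst h
    simp
  · exact Finset.sum_eq_zero fun k _ => if_neg fun hk => h (congrArg Sigma.fst hk)

theorem sElt_inr {ι : Type*} (o : ι → ℕ) (i i' : ι) : sElt ι o i (Sum.inr i') = 0 := by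
  simp [sElt]

theorem cElt_inl {ι : Type*} (o : ι → ℕ) (i : ι) (x : Σ i : ι, Fin (o i)) :
    cElt ι o i (Sum.inl x) = 0 := by
  simp [cElt]

open Classical in
theorem cElt_inr {ι : Type*} (o : ι → ℕ) (i i' : ι) :
    cElt ι o i (Sum.inr i') = if i = i' then 1 else 0 := by
  simp [cElt, Finsupp.single_apply]

/-- `G₀` consists of the elements whose coefficients on each line are constant and opposite to
the coefficient of the cycle representation. -/
theorem mem_Gzero_iff {ι : Type*} (o : ι → ℕ) (g : GG ι o) :
    g ∈ Gzero ι o ↔ ∀ (i : ι) (j : Fin (o i)), g (Sum.inl ⟨i, j⟩) = -g (Sum.inr i) := by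
  classical
  constructor
  · intro hg
    induction hg using AddSubgroup.closure_induction with
    | mem x hx =>
      obtain ⟨k, rfl⟩ := hx
      intro i j
      simp [toG_apply, sElt_inl, sElt_inr, cElt_inl, cElt_inr]
    | zero => simp
    | add x y _ _ hx hy =>
      intro i j
      simp only [Finsupp.add_apply, hx, hy]
      ring
    | neg x _ hx => simp [hx]
  · intro hg
    let c : ι →₀ ℤ := g.comapDomain Sum.inr Sum.inr_injective.injOn
    have hc (i : ι) : c i = g (Sum.inr i) := rfl
    have key : g = -c.sum fun i a => a • (toG ι o (sElt ι o i) - toG ι o (cElt ι o i)) := by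
      ext (⟨i, j⟩ | i)
      · simp [Finsupp.sum, toG_apply, sElt_inl, cElt_inl, hg, hc]
      · simp [Finsupp.sum, toG_apply, sElt_inr, cElt_inr, hc]
    rw [key]
    refine neg_mem (sum_mem fun i _ => zsmul_mem ?_ _)
    exact AddSubgroup.subset_closure ⟨i, rfl⟩

/-- Two elements of `M` differ by an element of `G₀` precisely when, on every line, the sum of
each coefficient and the cycle coefficient is the same. -/
theorem toG_sub_toG_mem_Gzero_iff {ι : Type*} (o : ι → ℕ) (f f' : MM ι o) :
    toG ι o f - toG ι o f' ∈ Gzero ι o ↔ ∀ (i : ι) (j : Fin (o i)),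
      f (Sum.inl ⟨i, j⟩) + f (Sum.inr i) = f' (Sum.inl ⟨i, j⟩) + f' (Sum.inr i) := by
  simp only [mem_Gzero_iff, Finsupp.sub_apply, toG_apply]
  exact forall₂_congr fun i j => by omega

/-- A C-parameter is determined by its class modulo `G₀`. -/
theorem CParSet_eq_of_sub_mem_Gzero {ι : Type*} (o : ι → ℕ) {f f' : MM ι o}
    (hf : f ∈ CParSet ι o) (hf' : f' ∈ CParSet ι o)
    (h : toG ι o f - toG ι o f' ∈ Gzero ι o) : f = f' := by
  rw [toG_sub_toG_mem_Gzero_iff] at h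
  have hr (i : ι) : f (Sum.inr i) = f' (Sum.inr i) := by
    obtain ⟨j, hj⟩ := hf i
    obtain ⟨j', hj'⟩ := hf' i
    have := h i j
    have := h i j'
    omega
  ext (⟨i, j⟩ | i)
  · have := h i j
    have := hr i
    omega
  · exact hr i

/-- Replacing every complete cycle of nilpotent indecomposables by the corresponding cycle
representation yields a C-parameter in the same class modulo `G₀`. -/
theorem exists_CParSet_sub_mem_Gzero {ι : Type*} (o : ι → ℕ) (ho : ∀ i, 1 ≤ o i) (f : MM ι o) :
    ∃ f' ∈ CParSet ι o, toG ι o f - toG ι o f' ∈ Gzero ι o := by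
  have hmin (i : ι) : ∃ j₀ : Fin (o i), ∀ j, f (Sum.inl ⟨i, j₀⟩) ≤ f (Sum.inl ⟨i, j⟩) :=
    have : Nonempty (Fin (o i)) := ⟨⟨0, ho i⟩⟩
    Finite.exists_min fun j => f (Sum.inl ⟨i, j⟩)
  choose j₀ hj₀ using hmin
  let m (i : ι) : ℕ := f (Sum.inl ⟨i, j₀ i⟩)
  let F : BB ι o → ℕ :=
    Sum.elim (fun x => f (Sum.inl x) - m x.1) (fun i => f (Sum.inr i) + m i)
  have hF : F.support.Finite := by
    refine (f.support.finite_toSet.union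
      ((f.support.finite_toSet.image (Sum.elim Sigma.fst id)).image Sum.inr)).subset ?_
    rintro (x | i) hx
    · left
      simp only [F, Function.mem_support, Sum.elim_inl] at hx
      simp only [Finset.mem_coe, Finsupp.mem_support_iff]
      omega
    · right
      refine ⟨i, ?_, rfl⟩
      by_cases hm : m i = 0
      · exact ⟨Sum.inr i, by simpa [F, hm] using hx, rfl⟩
      · exact ⟨Sum.inl ⟨i, j₀ i⟩, by simpa using hm, rfl⟩
  refine ⟨Finsupp.ofSupportFinite F hF, fun i => ⟨j₀ i, Nat.sub_self _⟩, ?_⟩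
  rw [toG_sub_toG_mem_Gzero_iff]
  intro i j
  have := hj₀ i j
  simp only [Finsupp.ofSupportFinite_coe, F, Sum.elim_inl, Sum.elim_inr, m]
  omega

/-- Canonical C-parameter representative (combining Propositions 4.1 and 4.3): every coset in
the image of `M` in `G ⧸ G₀` contains exactly one element of `CPar`. -/
theorem unique_CPar_representative
    {ι : Type*} (o : ι → ℕ) (ho : ∀ i, 1 ≤ o i) (f : MM ι o) :
    ∃! f' : MM ι o, f' ∈ CParSet ι o ∧ toG ι o f - toG ι o f' ∈ Gzero ι o := by
  obtain ⟨f', hf', hff'⟩ := exists_CParSet_sub_mem_Gzero o ho f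
  refine ⟨f', ⟨hf', hff'⟩, fun g ⟨hg, hfg⟩ => CParSet_eq_of_sub_mem_Gzero o hg hf' ?_⟩
  simpa using sub_mem hff' hfg
end

section
/- Every coset in the image h(M) of the full monoid M in G ⧸ G₀ contains exactly one element of Nilp: for every f ∈ M there exists a unique f' ∈ Nilp with f − f' ∈ G₀. (Canonical nilpotent representative; existence follows by replacing each c_i by s_i modulo G₀ and uniqueness is the injectivity assertion of Proposition 4.3.) -/
/-- The functional `g ↦ g (inl x) + g (inr x.1)` vanishes on `G₀`. -/
theorem apply_inl_add_apply_inr_of_mem_Gzero {ι : Type*} {o : ι → ℕ} {g : GG ι o}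
    (hg : g ∈ Gzero ι o) (x : Σ i : ι, Fin (o i)) :
    g (Sum.inl x) + g (Sum.inr x.1) = 0 := by
  classical
  induction hg using AddSubgroup.closure_induction with
  | mem g hg =>
    obtain ⟨i, rfl⟩ := hg
    obtain ⟨k, j⟩ := x
    by_cases h : i = k
    · subst h
      simp [toG, sElt, cElt, Finsupp.single_apply]
    · simp [toG, sElt, cElt, h]
  | zero => simp
  | add a b _ _ ha hb =>
    simp only [Finsupp.add_apply]
    linarith
  | neg a _ ha =>
    simp only [Finsupp.neg_apply]
    linarith

theorem sElt_mem_NilpSet {ι : Type*} (o : ι → ℕ) (i : ι) : sElt ι o i ∈ NilpSet ι o := by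
  intro k
  simp [sElt, Finsupp.finsetSum_apply]

/-- Every element of `M` is congruent modulo `G₀` to an element of `Nilp`. -/
theorem exists_mem_NilpSet_sub_mem_Gzero {ι : Type*} {o : ι → ℕ} (f : MM ι o) :
    ∃ f' ∈ NilpSet ι o, toG ι o f - toG ι o f' ∈ Gzero ι o := by
  induction f using Finsupp.induction_linear with
  | zero => exact ⟨0, fun _ => rfl, by simp⟩
  | add f g hf hg =>
    obtain ⟨f', hf', hf⟩ := hf
    obtain ⟨g', hg', hg⟩ := hg
    refine ⟨f' + g', fun i => by simp [hf' i, hg' i], ?_⟩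
    rw [map_add, map_add, add_sub_add_comm]
    exact add_mem hf hg
  | single b n =>
    rcases b with x | i
    · exact ⟨Finsupp.single (Sum.inl x) n, fun i => by simp, by simp⟩
    · refine ⟨n • sElt ι o i, fun k => by simp [sElt_mem_NilpSet o i k], ?_⟩
      have h : Finsupp.single (Sum.inr i) n = n • cElt ι o i := by simp [cElt]
      rw [h, map_nsmul, map_nsmul, ← nsmul_sub]
      refine nsmul_mem ?_ n
      rw [sub_mem_comm_iff]
      exact AddSubgroup.subset_closure ⟨i, rfl⟩

/-- Canonical nilpotent representative: every coset in the image of `M` in `G ⧸ G₀` contains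
exactly one element of `Nilp` (existence by replacing each `c_i` by `s_i` modulo `G₀`,
uniqueness being the injectivity assertion of Proposition 4.3). -/
theorem unique_Nilp_representative
    {ι : Type*} (o : ι → ℕ) (ho : ∀ i, 1 ≤ o i) (f : MM ι o) :
    ∃! f' : MM ι o, f' ∈ NilpSet ι o ∧ toG ι o f - toG ι o f' ∈ Gzero ι o := by
  obtain ⟨f', hf', h⟩ := exists_mem_NilpSet_sub_mem_Gzero f
  refine ⟨f', ⟨hf', h⟩, ?_⟩
  rintro g ⟨hg, hfg⟩
  have hmem : toG ι o f' - toG ι o g ∈ Gzero ι o := by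
    simpa using sub_mem hfg h
  ext (x | i)
  · have hx := apply_inl_add_apply_inr_of_mem_Gzero hmem x
    simp only [toG, Finsupp.mapRange.addMonoidHom_apply, Finsupp.sub_apply,
      Finsupp.mapRange_apply, Nat.coe_castAddMonoidHom, hf' x.1, hg x.1] at hx
    lia
  · rw [hf' i, hg i]
end

section
/- For every f ∈ Nilp and every i : ι, one has CV(f + s_i) = CV(f) + c_i. (Completing a cycle: adding a complete cycle St₀(ℤ_Ψ) of nilpotent indecomposables changes the associated C-parameter by adding the cycle representation 𝒞(ℤ_Ψ); this is the induction step in the proof of Proposition 4.1.) -/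
/-- `n_i = min_{j : Fin (o i)} f (inl (i, j))`, as a finitely supported family. -/
noncomputable def nmin (ι : Type*) [DecidableEq ι] (o : ι → ℕ) (ho : ∀ i, 1 ≤ o i)
    (f : MM ι o) : ι →₀ ℕ :=
  Finsupp.onFinset (f.support.image (Sum.elim (fun p => p.1) id))
    (fun i => Finset.univ.inf' (Finset.univ_nonempty_iff.mpr ⟨⟨0, ho i⟩⟩)
      (fun j : Fin (o i) => f (Sum.inl ⟨i, j⟩)))
    (by
      intro i hi
      have hj : f (Sum.inl ⟨i, ⟨0, ho i⟩⟩) ≠ 0 := by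
        intro h0
        exact hi (le_antisymm
          (le_trans (Finset.inf'_le _ (Finset.mem_univ (⟨0, ho i⟩ : Fin (o i)))) h0.le)
          (Nat.zero_le _))
      exact Finset.mem_image.mpr
        ⟨Sum.inl ⟨i, ⟨0, ho i⟩⟩, Finsupp.mem_support_iff.mpr hj, rfl⟩)

/-- The map `CV : f ↦ (f - Σ_i n_i • s_i) + Σ_i n_i • c_i`, where
`n_i = min_{j : Fin (o i)} f (inl (i, j))`: it replaces each complete cycle of nilpotent
indecomposables by the corresponding cycle representation. -/
noncomputable def CV (ι : Type*) [DecidableEq ι] (o : ι → ℕ) (ho : ∀ i, 1 ≤ o i)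
    (f : MM ι o) : MM ι o :=
  (f - (nmin ι o ho f).sum fun i k => k • sElt ι o i)
    + (nmin ι o ho f).sum fun i k => k • cElt ι o i

theorem sElt_apply_inl {ι : Type*} [DecidableEq ι] (o : ι → ℕ) (i k : ι) (j : Fin (o k)) :
    sElt ι o i (Sum.inl ⟨k, j⟩) = if i = k then 1 else 0 := by
  rw [sElt, Finsupp.finsetSum_apply]
  split_ifs with h
  · subst h
    simp [Finsupp.single_apply]
  · exact Finset.sum_eq_zero fun l _ => by simp [h]

theorem nmin_add_sElt {ι : Type*} [DecidableEq ι] (o : ι → ℕ) (ho : ∀ i, 1 ≤ o i)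
    (f : MM ι o) (i : ι) :
    nmin ι o ho (f + sElt ι o i) = nmin ι o ho f + Finsupp.single i 1 := by
  ext k
  have hne : (Finset.univ : Finset (Fin (o k))).Nonempty := ⟨⟨0, ho k⟩, Finset.mem_univ _⟩
  simp only [nmin, Finsupp.onFinset_apply, Finsupp.add_apply, sElt_apply_inl,
    Finsupp.single_apply]
  exact (Finset.apply_inf'_eq_inf'_comp hne (· + if i = k then 1 else 0)
    fun a b => (min_add_add_right a b _).symm).symm

theorem sum_smul_add_single {ι M : Type*} [AddCommMonoid M] (n : ι →₀ ℕ) (i : ι) (v : ι → M) :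
    ((n + Finsupp.single i 1).sum fun k m => m • v k) = (n.sum fun k m => m • v k) + v i := by
  classical
  rw [Finsupp.sum_add_index' (fun k => zero_smul ℕ (v k)) (fun k a b => add_smul a b (v k)),
    Finsupp.sum_single_index (zero_smul ℕ (v i)), one_smul]

/-- Completing a cycle (induction step in the proof of Proposition 4.1): adding a complete
cycle `s_i = St₀(ℤ_Ψ)` of nilpotent indecomposables changes the associated C-parameter by
adding the cycle representation `c_i = 𝒞(ℤ_Ψ)`. -/
theorem CV_add_cycle
    {ι : Type*} [DecidableEq ι] (o : ι → ℕ) (ho : ∀ i, 1 ≤ o i)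
    (f : MM ι o) (hf : f ∈ NilpSet ι o) (i : ι) :
    CV ι o ho (f + sElt ι o i) = CV ι o ho f + cElt ι o i := by
  simp only [CV, nmin_add_sElt, sum_smul_add_single, add_tsub_add_eq_tsub_right, add_assoc]
end
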